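/- Let F : ℕ → ℕ be a finitely supported function with F(i) = 0 for all i ≤ 3, and let V, E be natural numbers such that 3V = 2E, V + Σ_i F(i) = E + 2, and 2E = Σ_i i·F(i). Suppose moreover that the two inequalities 5·F(4) ≤ 4·F(7) + 5·F(8) + 5·F(9) + 7·F(10) + 7·F(11) + Σ_{i≥12} i·F(i) and 5·(F(5) + F(4)) ≤ 4·F(8) + 4·F(9) + 5·F(10) + 5·F(11) + Σ_{i≥12} ⌊i/2⌋·F(i) hold. Then a contradiction follows (no such data exist). (This is the global counting argument proving that a hypothetical minimal counterexample web, all of whose faces have at least 4 edges, cannot exist, i.e., the quantum sl(n) skein module of the plane or sphere has dimension 1.) -/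

import Mathlib

/-- Let `F : ℕ → ℕ` be finitely supported with `F i = 0` for `i ≤ 3`, and let `V`, `E`
be natural numbers with `3V = 2E`, `V + Σ_i F i = E + 2`, and `2E = Σ_i i·F i`.
If moreover the two face-neighborhood inequalities
`5·F 4 ≤ 4·F 7 + 5·F 8 + 5·F 9 + 7·F 10 + 7·F 11 + Σ_{i≥12} i·F i` and
`5·(F 5 + F 4) ≤ 4·F 8 + 4·F 9 + 5·F 10 + 5·F 11 + Σ_{i≥12} ⌊i/2⌋·F i` hold,
then a contradiction follows. -/
theorem no_minimal_counterexample_web (F : ℕ →₀ ℕ) (h0 : ∀ i ≤ 3, F i = 0)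
    (V E : ℕ)
    (h1 : 3 * V = 2 * E)
    (h2 : V + ∑ i ∈ F.support, F i = E + 2)
    (h3 : 2 * E = ∑ i ∈ F.support, i * F i)
    (h4 : 5 * F 4 ≤ 4 * F 7 + 5 * F 8 + 5 * F 9 + 7 * F 10 + 7 * F 11 +
      ∑ i ∈ F.support.filter (12 ≤ ·), i * F i)
    (h5 : 5 * (F 5 + F 4) ≤ 4 * F 8 + 4 * F 9 + 5 * F 10 + 5 * F 11 +
      ∑ i ∈ F.support.filter (12 ≤ ·), (i / 2) * F i) :
    False := by
  have key : ∀ g : ℕ → ℕ, ∑ i ∈ F.support, g i * F i =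
      ∑ i ∈ F.support.filter (12 ≤ ·), g i * F i + ∑ i ∈ Finset.range 12, g i * F i := by
    intro g
    rw [← Finset.sum_filter_add_sum_filter_not F.support (12 ≤ ·)]
    congr 1
    apply Finset.sum_subset
    · intro i hi
      simp at hi ⊢
      omega
    · intro i hi hn
      simp at hi hn ⊢
      right
      by_contra h
      exact absurd (hn h) (by omega)
  have k1 := key (fun _ => 1)
  have k2 := key (fun i => i)
  have k3 : ∑ i ∈ F.support.filter (12 ≤ ·), i * F i
      + ∑ i ∈ F.support.filter (12 ≤ ·), (i / 2) * F i
      + 30 * ∑ i ∈ F.support.filter (12 ≤ ·), F i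
      ≤ 5 * ∑ i ∈ F.support.filter (12 ≤ ·), i * F i := by
    rw [Finset.mul_sum, Finset.mul_sum, ← Finset.sum_add_distrib, ← Finset.sum_add_distrib]
    apply Finset.sum_le_sum
    intro i hi
    have hi' : 12 ≤ i := (Finset.mem_filter.mp hi).2
    have : i + i / 2 + 30 ≤ 5 * i := by omega
    have := Nat.mul_le_mul_right (F i) this
    nlinarith
  simp only [one_mul] at k1
  simp only [Finset.sum_range_succ, Finset.sum_range_zero] at k1 k2
  have e0 := h0 0 (by omega)
  have e1 := h0 1 (by omega)
  have e2 := h0 2 (by omega)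
  have e3 := h0 3 (by omega)
  omega
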